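/- arXiv:0807.5134 — 2 statements merged into one kernel-verified Lean document; each statement's English description precedes it below -/
import Mathlib

section
/- (Kantor) Let L be a finite-dimensional simple Lie algebra over ℂ equipped with a ℤ-grading given by a family of submodules V : ℤ → Submodule ℂ L such that L is the internal direct sum of the V(k), ⁅x, y⁆ ∈ V(i + j) whenever x ∈ V(i) and y ∈ V(j), V(1) ≠ ⊥, and L is generated as a Lie algebra by V(1) ∪ V(−1). Then there exist nonzero elements e ∈ V(1), f ∈ V(−1) and h ∈ V(0) satisfying the Chevalley relations ⁅e, f⁆ = h, ⁅h, e⁆ = 2 • e, and ⁅h, f⁆ = −2 • f. -/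
theorem kct_comm1 {R : Type*} [Ring R] (A B C : R) (hC : C = A * B - B * A) (hAC : A * C = C * A)
    (n : ℕ) : A ^ (n+1) * B = B * A ^ (n+1) + ((n : R) + 1) * (C * A ^ n) := by
  have hAB : A * B = B * A + C := by rw [hC]; abel
  have hcn : ∀ n : ℕ, A * (n : R) = n * A := fun n => (Nat.cast_commute n A).symm.eq
  induction n with
  | zero => simp [hAB]
  | succ n ih =>
    have h1 : A * (((n : R) + 1) * (C * A ^ n)) = ((n : R) + 1) * (C * A ^ (n+1)) := by
      have : A * ((n : R) + 1) = ((n : R) + 1) * A := by rw [mul_add, hcn, add_mul]; simp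
      rw [← mul_assoc, this, mul_assoc, ← mul_assoc A, hAC, pow_succ' A n]
      simp only [mul_assoc]
    rw [pow_succ' A (n+1), mul_assoc, ih, mul_add, h1, ← mul_assoc A, hAB]
    push_cast
    noncomm_ring

theorem kct_comm2 {R : Type*} [Ring R] (A Y H : R) (hH : H = A * Y - Y * A)
    (hAH : A * H = H * A - 2 * A)
    (n : ℕ) : A ^ (n+1) * Y = Y * A ^ (n+1) + ((n : R) + 1) * ((H - n) * A ^ n) := by
  have hAB : A * Y = Y * A + H := by rw [hH]; abel
  have hcn : ∀ n : ℕ, A * (n : R) = n * A := fun n => (Nat.cast_commute n A).symm.eq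
  have hcH : H * (n : R) = n * H := (Nat.cast_commute n H).symm.eq
  induction n with
  | zero => simp [hAB]
  | succ n ih =>
    have hcH : H * (n : R) = n * H := (Nat.cast_commute n H).symm.eq
    have h1 : A * (((n : R) + 1) * ((H - n) * A ^ n))
        = ((n : R) + 1) * ((H - n - 2) * A ^ (n+1)) := by
      have h2 : A * ((n : R) + 1) = ((n : R) + 1) * A := by rw [mul_add, hcn, add_mul]; simp
      have h3 : A * (H - n) = (H - n - 2) * A := by rw [mul_sub, hAH, hcn]; noncomm_ring
      rw [← mul_assoc, h2, mul_assoc, ← mul_assoc A, h3, pow_succ' A n]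
      simp only [mul_assoc]
    rw [pow_succ' A (n+1), mul_assoc, ih hcH, mul_add, h1, ← mul_assoc A, hAB]
    push_cast
    noncomm_ring
    

theorem kct_C_nilp {R : Type*} [Ring R] [Algebra ℂ R] (A B C : R) (hC : C = A * B - B * A)
    (hAC : A * C = C * A) (hA : IsNilpotent A) : IsNilpotent C := by
  set δ : Module.End ℂ R := LinearMap.mulLeft ℂ A - LinearMap.mulRight ℂ A with hδ
  have hd : ∀ X, δ X = A * X - X * A := fun X => by simp [hδ]
  have hδn : IsNilpotent δ := by
    have hl : IsNilpotent (LinearMap.mulLeft ℂ A) := by rwa [LinearMap.isNilpotent_mulLeft_iff]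
    have hr : IsNilpotent (LinearMap.mulRight ℂ A) := by rwa [LinearMap.isNilpotent_mulRight_iff]
    exact (LinearMap.commute_mulLeft_right A A).isNilpotent_sub hl hr
  have hmul : ∀ X Z, δ (X * Z) = δ X * Z + X * δ Z := fun X Z => by
    simp only [hd]; noncomm_ring
  have hB : δ B = C := by rw [hd, hC]
  have hCz : δ C = 0 := by rw [hd, hAC, sub_self]
  have leib : ∀ (k : ℕ) (X : R), (δ ^ (k+1)) (X * B)
      = (δ ^ (k+1)) X * B + ((k : ℂ) + 1) • ((δ ^ k) X * C) := by
    intro k X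
    induction k with
    | zero => simp [hmul, hB]
    | succ k ih =>
      rw [pow_succ' δ (k+1), Module.End.mul_apply, ih, map_add, map_smul, hmul, hmul, hB, hCz,
        Module.End.mul_apply, mul_zero, add_zero, ← Module.End.mul_apply δ (δ ^ k), ← pow_succ']
      push_cast
      module
  have main : ∀ n : ℕ, (δ ^ n) (B ^ n) = (n.factorial : ℂ) • C ^ n ∧ (δ ^ (n+1)) (B ^ n) = 0 := by
    intro n
    induction n with
    | zero => simp [hd]
    | succ n ih =>
      have h0 : (δ ^ (n+1)) (B ^ (n+1)) = ((n+1).factorial : ℂ) • C ^ (n+1) := by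
        rw [pow_succ B n, leib, ih.2, ih.1, Nat.factorial_succ, pow_succ C n]
        push_cast
        simp [mul_smul]
      refine ⟨h0, ?_⟩
      have hCn : ∀ n : ℕ, δ (C ^ n) = 0 := by
        intro n
        induction n with
        | zero => simp [hd]
        | succ n ih => rw [pow_succ, hmul, ih, hCz]; simp
      rw [pow_succ' δ (n+1), Module.End.mul_apply, h0, map_smul, hCn, smul_zero]
  obtain ⟨n, hn⟩ := hδn
  refine ⟨n, ?_⟩
  have := (main n).1
  rw [hn, LinearMap.zero_apply] at this
  exact (smul_eq_zero.mp this.symm).resolve_left (by exact_mod_cast n.factorial_ne_zero)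

theorem kct_AB_nilp {M : Type*} [AddCommGroup M] [Module ℂ M] (A B C : Module.End ℂ M)
    (hC : C = A * B - B * A)
    (hAC : A * C = C * A) (hA : IsNilpotent A) : IsNilpotent (A * B) := by
  obtain ⟨r, hr⟩ := kct_C_nilp A B C hC hAC hA
  obtain ⟨m, hm⟩ := hA
  have step : ∀ (n : ℕ) (v : M), (A ^ (n+1)) v = 0 →
      (A ^ n) ((A * B) v) = ((n : ℂ) + 1) • C ((A ^ n) v) := by
    intro n v hv
    have := congrArg (fun T : Module.End ℂ M => T v) (kct_comm1 A B C hC hAC n)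
    simp only [Module.End.mul_apply, LinearMap.add_apply, hv, map_zero, zero_add] at this
    rw [pow_succ, Module.End.mul_apply] at this
    rw [Module.End.mul_apply, this, add_smul]
    simp [Module.End.natCast_apply, Nat.cast_smul_eq_nsmul]
  have hCA : ∀ n, A ^ n * C = C * A ^ n := fun n => (Commute.pow_left (show Commute A C from hAC) n).eq
  have step2 : ∀ (n k : ℕ) (v : M), (A ^ (n+1)) v = 0 →
      (A ^ n) (((A * B) ^ k) v) = ((n : ℂ) + 1) ^ k • (C ^ k) ((A ^ n) v) ∧
      (A ^ (n+1)) (((A * B) ^ k) v) = 0 := by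
    intro n k v hv
    induction k with
    | zero => simp [hv]
    | succ k ih =>
      have e1 : (A ^ n) (((A * B) ^ (k+1)) v)
          = ((n : ℂ) + 1) ^ (k+1) • (C ^ (k+1)) ((A ^ n) v) := by
        rw [pow_succ' (A * B), Module.End.mul_apply, step n _ ih.2, ih.1, map_smul, smul_smul,
          ← pow_succ', ← Module.End.mul_apply, ← pow_succ']
      refine ⟨e1, ?_⟩
      rw [pow_succ', Module.End.mul_apply, e1, map_smul, ← Module.End.mul_apply,
        (Commute.pow_right (show Commute A C from hAC) (k+1)).eq, Module.End.mul_apply,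
        ← Module.End.mul_apply A, ← pow_succ', hv]
      simp
  have fin : ∀ (n : ℕ) (v : M), (A ^ n) v = 0 → ((A * B) ^ (r * n)) v = 0 := by
    intro n
    induction n with
    | zero => intro v hv; simpa using hv
    | succ n ih =>
      intro v hv
      rw [Nat.mul_succ, pow_add, Module.End.mul_apply]
      apply ih
      rw [(step2 n r v hv).1, hr]
      simp
  refine ⟨r * m, LinearMap.ext fun v => fin m v (by rw [hm]; rfl)⟩

theorem kct_ad_nilp {L : Type*} [LieRing L] [LieAlgebra ℂ L]
    [FiniteDimensional ℂ L] (V : ℤ → Submodule ℂ L)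
    (hdirect : DirectSum.IsInternal V)
    (hgrade : ∀ (i j : ℤ) (x y : L), x ∈ V i → y ∈ V j → ⁅x, y⁆ ∈ V (i + j))
    (e : L) (he : e ∈ V 1) : IsNilpotent (LieAlgebra.ad ℂ L e : Module.End ℂ L) := by
  have hfin : {i | V i ≠ ⊥}.Finite :=
    WellFoundedGT.finite_ne_bot_of_iSupIndep hdirect.submodule_iSupIndep
  obtain ⟨b, hb⟩ := hfin.bddAbove
  obtain ⟨a, ha⟩ := hfin.bddBelow
  set A : Module.End ℂ L := LieAlgebra.ad ℂ L e with hA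
  have hpow : ∀ (n : ℕ) (k : ℤ) (x : L), x ∈ V k → (A ^ n) x ∈ V (k + n) := by
    intro n k x hx
    induction n with
    | zero => simpa using hx
    | succ n ih =>
      rw [pow_succ', Module.End.mul_apply]
      have := hgrade 1 _ e _ he ih
      rw [hA, LieAlgebra.ad_apply]
      rw [show (k + (n + 1 : ℕ) : ℤ) = 1 + (k + n) by push_cast; ring]
      exact this
  refine ⟨(b - a + 1).toNat, LinearMap.ext fun v => ?_⟩
  have hv : v ∈ ⨆ i, V i := by rw [hdirect.submodule_iSup_eq_top]; trivial
  induction hv using Submodule.iSup_induction' with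
  | mem i x hx =>
    by_cases hi : V i = ⊥
    · rw [hi, Submodule.mem_bot] at hx
      simp [hx]
    · have h1 := hpow (b - a + 1).toNat i x hx
      have h2 : V (i + (b - a + 1).toNat) = ⊥ := by
        by_contra hne
        have h3 := hb hne
        have h4 := ha (show V i ≠ ⊥ from hi)
        have := Int.self_le_toNat (b - a + 1)
        omega
      rw [h2, Submodule.mem_bot] at h1
      exact h1
  | zero => simp
  | add x y _ _ hx hy => rw [map_add, hx, hy, map_add]

theorem kct_mem_range {L : Type*} [LieRing L] [LieAlgebra ℂ L]
    [FiniteDimensional ℂ L] [LieAlgebra.IsSimple ℂ L] (e : L)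
    (hA : IsNilpotent (LieAlgebra.ad ℂ L e : Module.End ℂ L)) : ∃ x, ⁅e, ⁅e, x⁆⁆ = e := by
  set A : Module.End ℂ L := LieAlgebra.ad ℂ L e with hAdef
  have hA' : ∀ x, A x = ⁅e, x⁆ := fun x => LieAlgebra.ad_apply ℂ L e x
  have hnd := LieAlgebra.IsKilling.killingForm_nondegenerate ℂ L
  have hrefl : (killingForm ℂ L).IsRefl := (LieModule.traceForm_isSymm ℂ L L).isRefl
  suffices h : e ∈ LinearMap.range (A ^ 2) by
    obtain ⟨x, hx⟩ := h
    exact ⟨x, by simpa [pow_two, hA'] using hx⟩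
  rw [← LinearMap.BilinForm.orthogonal_orthogonal hnd hrefl (LinearMap.range (A ^ 2))]
  rw [LinearMap.BilinForm.mem_orthogonal_iff]
  intro z hz
  rw [LinearMap.BilinForm.mem_orthogonal_iff] at hz
  have hz2 : ⁅e, ⁅e, z⁆⁆ = 0 := by
    have hall : ∀ x, killingForm ℂ L x ⁅e, ⁅e, z⁆⁆ = 0 := by
      intro x
      have h1 : killingForm ℂ L ⁅e, ⁅e, x⁆⁆ z = 0 := by
        have := hz ((A ^ 2) x) ⟨x, rfl⟩
        simpa [pow_two, hA'] using this
      have h2 : ⁅e, ⁅e, x⁆⁆ = ⁅⁅x, e⁆, e⁆ := by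
        rw [← lie_skew ⁅x, e⁆ e, ← lie_skew x e, lie_neg, neg_neg]
      rw [h2] at h1
      rw [← h1, LieModule.traceForm_apply_lie_apply, LieModule.traceForm_apply_lie_apply]
    exact hnd.2 _ hall
  have : killingForm ℂ L e z = 0 := by
    rw [killingForm_apply_apply]
    set B : Module.End ℂ L := LieAlgebra.ad ℂ L z with hBdef
    have hn : IsNilpotent (A * B) := by
      refine kct_AB_nilp A B (LieAlgebra.ad ℂ L ⁅e, z⁆ : Module.End ℂ L) ?_ ?_ hA
      · ext x
        simp [hAdef, hBdef]
      · ext x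
        have := leibniz_lie e ⁅e, z⁆ x
        rw [hz2, zero_lie, zero_add] at this
        simpa only [Module.End.mul_apply, hA', LieAlgebra.ad_apply] using this
    exact (LinearMap.isNilpotent_trace_of_isNilpotent hn).eq_zero
  exact hrefl _ _ this

theorem kct_component {L : Type*} [LieRing L] [LieAlgebra ℂ L]
    (V : ℤ → Submodule ℂ L)
    (hdirect : DirectSum.IsInternal V)
    (hgrade : ∀ (i j : ℤ) (x y : L), x ∈ V i → y ∈ V j → ⁅x, y⁆ ∈ V (i + j))
    (e : L) (he : e ∈ V 1) (x : L) (hx : ⁅e, ⁅e, x⁆⁆ = e) :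
    ∃ y ∈ V (-1), ⁅e, ⁅e, y⁆⁆ = e := by
  classical
  let _ := hdirect.chooseDecomposition
  have key : ∀ v : L, ⁅e, ⁅e, (DirectSum.decompose V v (-1) : L)⁆⁆
      = (DirectSum.decompose V ⁅e, ⁅e, v⁆⁆ 1 : L) := by
    intro v
    induction v using DirectSum.Decomposition.inductionOn V with
    | zero => simp
    | @homogeneous i m =>
      have h2 : ⁅e, ⁅e, (m : L)⁆⁆ ∈ V (1 + (1 + i)) := hgrade _ _ _ _ he (hgrade _ _ _ _ he m.2)
      by_cases hi : i = -1
      · subst hi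
        rw [DirectSum.decompose_of_mem_same V m.2, DirectSum.decompose_of_mem_same V (by simpa using h2)]
      · rw [DirectSum.decompose_of_mem_ne V m.2 hi, DirectSum.decompose_of_mem_ne V h2 (by omega)]
        simp
    | add a b ha hb =>
      simp only [DirectSum.decompose_add, DirectSum.add_apply, Submodule.coe_add, lie_add, ha, hb]
  refine ⟨_, (DirectSum.decompose V x (-1)).2, ?_⟩
  rw [key, hx, DirectSum.decompose_of_mem_same V he]

theorem kct_inj {L : Type*} [LieRing L] [LieAlgebra ℂ L] (e h y : L) (hh : ⁅e, y⁆ = h)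
    (hhe : ⁅h, e⁆ = (2 : ℂ) • e)
    (hnil : IsNilpotent (LieAlgebra.ad ℂ L e : Module.End ℂ L)) (z : L) (hz : ⁅e, z⁆ = 0)
    (hz2 : ⁅h, z⁆ + (2 : ℂ) • z = 0) : z = 0 := by
  set A : Module.End ℂ L := LieAlgebra.ad ℂ L e with hA
  set Y : Module.End ℂ L := LieAlgebra.ad ℂ L y with hY
  set H : Module.End ℂ L := LieAlgebra.ad ℂ L h with hH
  have hAz : A z = 0 := by rw [hA, LieAlgebra.ad_apply, hz]
  have hHz : H z = (-2 : ℂ) • z := by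
    rw [hH, LieAlgebra.ad_apply, eq_neg_of_add_eq_zero_left hz2]; module
  have e1 : H = A * Y - Y * A := by
    ext x
    simp [hA, hY, hH, ← hh]
  have e2 : A * H = H * A - 2 * A := by
    ext x
    have h1 := leibniz_lie h e x
    rw [hhe, smul_lie] at h1
    have h2 : (2 : Module.End ℂ L) ⁅e, x⁆ = (2 : ℂ) • ⁅e, x⁆ := by
      rw [← one_add_one_eq_two, two_smul]; simp
    simp only [Module.End.mul_apply, LinearMap.sub_apply, hA, hH, LieAlgebra.ad_apply, h1, h2]
    abel
  have main : ∀ n : ℕ, ∃ x, (A ^ n) x = z := by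
    intro n
    induction n with
    | zero => exact ⟨z, by simp⟩
    | succ n ih =>
      obtain ⟨x, hx⟩ := ih
      have h1 := congrArg (fun T : Module.End ℂ L => T x) (kct_comm2 A Y H e1 e2 n)
      have h0 : (A ^ (n+1)) x = 0 := by rw [pow_succ', Module.End.mul_apply, hx, hAz]
      have h3 : (((n : Module.End ℂ L) + 1) * ((H - n) * A ^ n)) x
          = (((n : ℂ) + 1) * (-2 - n)) • z := by
        have hn : ∀ v : L, (n : Module.End ℂ L) v = (n : ℂ) • v := fun v => by
          rw [Module.End.natCast_apply, Nat.cast_smul_eq_nsmul]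
        simp only [Module.End.mul_apply, LinearMap.add_apply, LinearMap.sub_apply, hx, hHz, hn,
          Module.End.one_apply]
        module
      have h4 : (A ^ (n+1)) (Y x) = (((n : ℂ) + 1) * (-2 - n)) • z := by
        rw [← h3]
        simpa only [Module.End.mul_apply, LinearMap.add_apply, h0, map_zero, zero_add] using h1
      have hc : ((n : ℂ) + 1) * (-2 - n) ≠ 0 := by
        have h5 : (n : ℂ) + 1 ≠ 0 := Nat.cast_add_one_ne_zero n
        have h6 : ((n + 2 : ℕ) : ℂ) ≠ 0 := Nat.cast_ne_zero.mpr (by omega)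
        refine mul_ne_zero h5 ?_
        rw [show (-2 - n : ℂ) = -((n + 2 : ℕ) : ℂ) by push_cast; ring]
        exact neg_ne_zero.mpr h6
      exact ⟨(((n : ℂ) + 1) * (-2 - n))⁻¹ • Y x, by rw [map_smul, h4, smul_smul, inv_mul_cancel₀ hc, one_smul]⟩
  obtain ⟨m, hm⟩ := hnil
  obtain ⟨x, hx⟩ := main m
  rw [← hx, hm]; rfl

/-- (Kantor) A finite-dimensional simple complex Lie algebra with a ℤ-grading which is
generated by its levels `±1` (and has nontrivial level `1`) contains a Chevalley
(sl₂) triple `e, f, h` at levels `1, -1, 0`. -/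
theorem kantor_chevalley_triple {L : Type*} [LieRing L] [LieAlgebra ℂ L]
    [FiniteDimensional ℂ L] [LieAlgebra.IsSimple ℂ L]
    (V : ℤ → Submodule ℂ L)
    (hdirect : DirectSum.IsInternal V)
    (hgrade : ∀ (i j : ℤ) (x y : L), x ∈ V i → y ∈ V j → ⁅x, y⁆ ∈ V (i + j))
    (hone : V 1 ≠ ⊥)
    (hgen : LieSubalgebra.lieSpan ℂ L ((V 1 : Set L) ∪ (V (-1) : Set L)) = ⊤) :
    ∃ e f h : L, e ∈ V 1 ∧ f ∈ V (-1) ∧ h ∈ V 0 ∧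
      e ≠ 0 ∧ f ≠ 0 ∧ h ≠ 0 ∧
      ⁅e, f⁆ = h ∧ ⁅h, e⁆ = (2 : ℂ) • e ∧ ⁅h, f⁆ = -((2 : ℂ) • f) := by
  obtain ⟨e, he1, he0⟩ := Submodule.exists_mem_ne_zero_of_ne_bot hone
  have hAnil := kct_ad_nilp V hdirect hgrade e he1
  -- find the neutral element
  obtain ⟨x0, hx0⟩ := kct_mem_range e hAnil
  obtain ⟨y0, hy0, hy0e⟩ : ∃ y0 ∈ V (-1), ⁅e, ⁅e, y0⁆⁆ = e :=
    kct_component V hdirect hgrade e he1 x0 hx0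
  set y := (-2 : ℂ) • y0 with hy
  have hyV : y ∈ V (-1) := Submodule.smul_mem _ _ hy0
  set h := ⁅e, y⁆ with hh
  have hhV : h ∈ V 0 := by simpa using hgrade 1 (-1) e y he1 hyV
  have hhe : ⁅h, e⁆ = (2 : ℂ) • e := by
    rw [← lie_skew, hh, hy, lie_smul, lie_smul, hy0e]; module
  have heh : ⁅e, h⁆ = -((2 : ℂ) • e) := by rw [← lie_skew, hhe]
  clear_value h y
  -- injectivity on the centralizer of e
  have hinj : ∀ z : L, ⁅e, z⁆ = 0 → ⁅h, z⁆ + (2 : ℂ) • z = 0 → z = 0 :=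
    kct_inj e h y hh.symm hhe hAnil
  let K : Submodule ℂ L := LinearMap.ker (LieAlgebra.ad ℂ L e : Module.End ℂ L) ⊓ V (-1)
  let T : Module.End ℂ L := (LieAlgebra.ad ℂ L h : Module.End ℂ L) + (2 : ℂ) • (1 : Module.End ℂ L)
  have hT : ∀ z, T z = ⁅h, z⁆ + (2 : ℂ) • z := fun z => by simp [T]
  have hK : ∀ z, z ∈ K ↔ ⁅e, z⁆ = 0 ∧ z ∈ V (-1) := fun z => by simp [K]
  have hTV : ∀ z ∈ V (-1), T z ∈ V (-1) := fun z hz => by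
    rw [hT]
    exact Submodule.add_mem _ (by simpa using hgrade 0 (-1) h z hhV hz) (Submodule.smul_mem _ _ hz)
  have hTK : ∀ z ∈ K, T z ∈ K := fun z hz => by
    rw [hK] at hz ⊢
    refine ⟨?_, hTV z hz.2⟩
    rw [hT, lie_add, lie_smul, hz.1, leibniz_lie, hz.1, heh, neg_lie, smul_lie, hz.1]
    simp
  have hTinj : Function.Injective (T.restrict hTK) := by
    rw [injective_iff_map_eq_zero]
    intro z hz
    have h1 : T z.1 = 0 := congrArg Subtype.val hz
    rw [hT] at h1
    exact Subtype.ext (hinj z.1 ((hK _).1 z.2).1 h1)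
  have hTsurj : Function.Surjective (T.restrict hTK) := LinearMap.surjective_of_injective hTinj
  have hwK : T y ∈ K := by
    rw [hK]
    refine ⟨?_, hTV y hyV⟩
    rw [hT, lie_add, lie_smul, leibniz_lie, heh, neg_lie, smul_lie, ← hh, lie_self]
    simp
  obtain ⟨z, hz⟩ := hTsurj ⟨T y, hwK⟩
  have hz' : T z.1 = T y := congrArg Subtype.val hz
  have hzK := (hK _).1 z.2
  have hef : ⁅e, y - z.1⁆ = h := by rw [lie_sub, hzK.1, sub_zero, hh]
  have hh0 : h ≠ 0 := by
    intro h0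
    rw [h0, zero_lie] at hhe
    exact he0 ((smul_eq_zero.mp hhe.symm).resolve_left two_ne_zero)
  refine ⟨e, y - z.1, h, he1, Submodule.sub_mem _ hyV hzK.2, hhV, he0, ?_, hh0, hef, hhe, ?_⟩
  · intro h0
    rw [h0, lie_zero] at hef
    exact hh0 hef.symm
  · rw [hT, hT] at hz'
    have h2 : ⁅h, z.1⁆ = ⁅h, y⁆ + (2 : ℂ) • y - (2 : ℂ) • z.1 := by rw [← hz']; abel
    rw [lie_sub, h2]
    module
end

section
/- Let L be a simple Lie algebra over ℂ equipped with a ℤ-grading given by a family of submodules V : ℤ → Submodule ℂ L such that L is the internal direct sum of the V(k), ⁅x, y⁆ ∈ V(i + j) whenever x ∈ V(i) and y ∈ V(j), V(1) ≠ ⊥, and L is generated as a Lie algebra by V(1) ∪ V(−1). Suppose further there is a conjugate-linear map τ : L → L (additive, with τ(c • x) = conj(c) • τ(x)) satisfying τ(τ(x)) = x, τ⁅x, y⁆ = ⁅τ(x), τ(y)⁆, and τ(V(k)) ⊆ V(−k) for all k, and such that the triple product is antisymmetric in its first and third arguments on level one: ⁅⁅x, τ(y)⁆, z⁆ = −⁅⁅z,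 τ(y)⁆, x⁆ for all x, y, z ∈ V(1). Then L is infinite-dimensional (not finite-dimensional over ℂ). -/
theorem aux_comm_pow {R : Type*} [Ring R] {A B C : R} (hC : A * B - B * A = C)
    (hAC : A * C = C * A) (m : ℕ) : A ^ (m + 1) * B = B * A ^ (m + 1) + (m + 1 : ℕ) • (A ^ m * C) := by
  have h1 : A * B = B * A + C := by rw [← hC]; abel
  induction m with
  | zero => simp [h1]
  | succ m ih =>
    have hc : C * A ^ (m + 1) = A ^ (m + 1) * C :=
      ((show Commute A C from hAC).pow_left (m + 1)).eq.symm
    calc A ^ (m + 1 + 1) * B = A * (A ^ (m + 1) * B) := by rw [pow_succ' A (m + 1)]; noncomm_ring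
      _ = (A * B) * A ^ (m + 1) + (m + 1 : ℕ) • (A * A ^ m * C) := by
        rw [ih, mul_add, mul_smul_comm]; simp only [mul_assoc]
      _ = B * (A * A ^ (m + 1)) + C * A ^ (m + 1) + (m + 1 : ℕ) • (A ^ (m + 1) * C) := by
        rw [h1, ← pow_succ' A m]; simp only [add_mul, mul_assoc]
      _ = _ := by rw [hc, ← pow_succ', add_assoc, succ_nsmul' (A ^ (m + 1) * C) (m + 1)]

theorem aux_C_nil {R : Type*} [Ring R] [Algebra ℂ R] {A B C : R} (hC : A * B - B * A = C)
    (hAC : A * C = C * A) (hBC : B * C = C * B) (m : ℕ) :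
    ∀ k, C ^ k * A ^ m = 0 → C ^ (k + m) = 0 := by
  induction m with
  | zero => intro k h; simpa using h
  | succ m ih =>
    intro k h
    have hb : C ^ k * B = B * C ^ k := ((show Commute B C from hBC).pow_right k).eq.symm
    have hc : A ^ m * C = C * A ^ m := ((show Commute A C from hAC).pow_left m).eq
    have h2 : (m + 1 : ℕ) • (C ^ (k + 1) * A ^ m) = 0 := by
      have e := congrArg (C ^ k * ·) (aux_comm_pow hC hAC m)
      simp only [mul_add, mul_smul_comm] at e
      rw [← mul_assoc, ← mul_assoc, h, hb, mul_assoc, h, hc, ← mul_assoc, ← pow_succ] at e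
      simpa using e.symm
    have h3 : C ^ (k + 1) * A ^ m = 0 := by
      rw [← Nat.cast_smul_eq_nsmul ℂ] at h2
      exact (smul_eq_zero.mp h2).resolve_left (by exact_mod_cast Nat.succ_ne_zero m)
    have := ih (k + 1) h3
    rwa [show k + 1 + m = k + (m + 1) by ring] at this

theorem aux_nil {R : Type*} [Ring R] [Algebra ℂ R] {A B C : R} (hC : A * B - B * A = C)
    (hAC : A * C = C * A) (hBC : B * C = C * B) (hA : IsNilpotent A) : IsNilpotent (B * A) := by
  obtain ⟨n, hn⟩ := hA
  have hCn : IsNilpotent C := ⟨n, by simpa using aux_C_nil hC hAC hBC n 0 (by simp [hn])⟩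
  have cA : Commute A C := hAC
  have cB : Commute B C := hBC
  have key : ∀ k : ℕ, ∃ Q, Commute C Q ∧ (B * A) ^ k = B ^ k * A ^ k + C * Q := by
    intro k
    induction k with
    | zero => exact ⟨0, Commute.zero_right _, by simp⟩
    | succ k ih =>
      obtain ⟨Q, hQ, e⟩ := ih
      have hP : Commute C (B ^ k * A ^ k) :=
        ((cB.symm.pow_right k).mul_right (cA.symm.pow_right k))
      have e2 : A ^ k * B * A = B * A ^ (k + 1) + k • (A ^ k * C) := by
        cases k with
        | zero => simp
        | succ m =>
          rw [aux_comm_pow hC hAC m, add_mul, smul_mul_assoc, mul_assoc, ← pow_succ,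
            mul_assoc, ← hAC, ← mul_assoc (A ^ m), ← pow_succ]
      refine ⟨k • (B ^ k * A ^ k) + Q * (B * A),
        (hP.smul_right k).add_right (hQ.mul_right (cB.symm.mul_right cA.symm)), ?_⟩
      calc (B * A) ^ (k + 1) = B ^ k * (A ^ k * B * A) + C * Q * (B * A) := by
            rw [pow_succ, e, add_mul]; simp only [mul_assoc]
        _ = B ^ (k + 1) * A ^ (k + 1) + k • ((B ^ k * A ^ k) * C) + C * Q * (B * A) := by
            rw [e2, mul_add, mul_smul_comm, pow_succ B]; simp only [mul_assoc]
        _ = _ := by rw [← hP.eq, mul_add, mul_smul_comm, add_assoc, mul_assoc C Q]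
  obtain ⟨Q, hQ, e⟩ := key n
  rw [hn, mul_zero, zero_add] at e
  exact (IsNilpotent.pow_iff_pos (n := n + 1) (by omega)).1 (by
    rw [pow_succ, e, mul_assoc]
    exact (hQ.mul_right (cB.symm.mul_right cA.symm)).isNilpotent_mul_right hCn |> fun h => by
      simpa using h)

theorem aux_graded_nil {E : Type*} [AddCommGroup E] [Module ℂ E] [FiniteDimensional ℂ E]
    (V : ℤ → Submodule ℂ E) (hdirect : DirectSum.IsInternal V) (T : Module.End ℂ E)
    (hT : ∀ i, ∀ x ∈ V i, T x ∈ V (i + 1)) : IsNilpotent T := by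
  have hfin : {i | V i ≠ ⊥}.Finite :=
    WellFoundedGT.finite_ne_bot_of_iSupIndep hdirect.submodule_iSupIndep
  obtain ⟨a, ha⟩ := hfin.bddBelow
  obtain ⟨b, hb⟩ := hfin.bddAbove
  have hpow : ∀ (n : ℕ) (i : ℤ), ∀ x ∈ V i, (T ^ n) x ∈ V (i + n) := by
    intro n
    induction n with
    | zero => intro i x hx; simpa using hx
    | succ n ih =>
      intro i x hx
      rw [pow_succ', Module.End.mul_apply]
      have := hT _ _ (ih i x hx)
      rwa [add_assoc] at this
  refine ⟨(b - a + 1).toNat, ?_⟩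
  rw [← LinearMap.ker_eq_top, eq_top_iff, ← hdirect.submodule_iSup_eq_top, iSup_le_iff]
  intro i x hx
  rw [LinearMap.mem_ker]
  by_cases hi : V i = ⊥
  · rw [hi, Submodule.mem_bot] at hx
    rw [hx, map_zero]
  · have h1 : a ≤ i := ha hi
    have h2 : V (i + (b - a + 1).toNat) = ⊥ := by
      by_contra h
      have : i + ((b - a + 1).toNat : ℤ) ≤ b := hb h
      omega
    have := hpow (b - a + 1).toNat i x hx
    rwa [h2, Submodule.mem_bot] at this


/-- A simple complex Lie algebra with a ℤ-grading generated by its levels `±1`,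
equipped with a conjugate-linear graded involution whose associated triple product
is antisymmetric in the first and third arguments on level one, must be
infinite-dimensional. -/
theorem infinite_dimensional_of_antisymmetric_triple {L : Type*} [LieRing L]
    [LieAlgebra ℂ L] [LieAlgebra.IsSimple ℂ L]
    (V : ℤ → Submodule ℂ L)
    (hdirect : DirectSum.IsInternal V)
    (hgrade : ∀ (i j : ℤ) (x y : L), x ∈ V i → y ∈ V j → ⁅x, y⁆ ∈ V (i + j))
    (hone : V 1 ≠ ⊥)
    (hgen : LieSubalgebra.lieSpan ℂ L ((V 1 : Set L) ∪ (V (-1) : Set L)) = ⊤)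
    (τ : L → L)
    (hadd : ∀ x y : L, τ (x + y) = τ x + τ y)
    (hsmul : ∀ (c : ℂ) (x : L), τ (c • x) = (starRingEnd ℂ c) • τ x)
    (hinv : ∀ x : L, τ (τ x) = x)
    (hbr : ∀ x y : L, τ ⁅x, y⁆ = ⁅τ x, τ y⁆)
    (hgradedτ : ∀ (k : ℤ) (x : L), x ∈ V k → τ x ∈ V (-k))
    (hanti : ∀ x y z : L, x ∈ V 1 → y ∈ V 1 → z ∈ V 1 →
      ⁅⁅x, τ y⁆, z⁆ = -⁅⁅z, τ y⁆, x⁆) :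
    ¬ FiniteDimensional ℂ L := by
  intro hfd
  have hz : ∀ v : L, v = -v → v = 0 := by
    intro v hv
    have h2 : (2 : ℂ) • v = 0 := by
      rw [two_smul]; nth_rewrite 1 [hv]; simp
    exact (smul_eq_zero.mp h2).resolve_left two_ne_zero
  have hL : ∀ a b : L, LieAlgebra.ad ℂ L ⁅a, b⁆ =
      LieAlgebra.ad ℂ L a * LieAlgebra.ad ℂ L b - LieAlgebra.ad ℂ L b * LieAlgebra.ad ℂ L a := by
    intro a b
    ext v
    simp [lie_lie]
  have hτ0 : τ 0 = 0 := by simpa using hadd 0 0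
  obtain ⟨x, hx, hx0⟩ := (Submodule.ne_bot_iff _).1 hone
  have hnil : IsNilpotent (LieAlgebra.ad ℂ L x) := by
    apply aux_graded_nil V hdirect
    intro i y hy
    rw [add_comm]
    exact hgrade 1 i x y hx hy
  have hk : ∀ w ∈ V (-1), killingForm ℂ L x w = 0 := by
    intro w hw
    have hy : τ w ∈ V 1 := by simpa using hgradedτ _ _ hw
    have h1 : ⁅⁅x, w⁆, x⁆ = 0 := by
      apply hz
      have := hanti x (τ w) x hx hy hx
      rwa [hinv] at this
    have h2 : ⁅⁅x, w⁆, w⁆ = 0 := by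
      have h3 : ⁅⁅τ w, τ x⁆, τ w⁆ = 0 := hz _ (hanti (τ w) x (τ w) hy hx hy)
      have h4 := congrArg τ h3
      rw [hbr, hbr, hinv, hinv, hτ0, ← lie_skew w x, neg_lie, neg_eq_zero] at h4
      exact h4
    have hn := aux_nil (A := LieAlgebra.ad ℂ L x) (B := LieAlgebra.ad ℂ L w)
      (C := LieAlgebra.ad ℂ L ⁅x, w⁆)
      (hL x w).symm
      (by rw [eq_comm, ← sub_eq_zero, ← hL, h1, map_zero])
      (by rw [eq_comm, ← sub_eq_zero, ← hL, h2, map_zero])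
      hnil
    rw [killingForm_apply_apply, LinearMap.trace_comp_comm']
    exact (LinearMap.isNilpotent_trace_of_isNilpotent hn).eq_zero
  have hk0 : ∀ j, ∀ w ∈ V j, killingForm ℂ L x w = 0 := by
    intro j w hw
    by_cases hj : j = -1
    · subst hj; exact hk w hw
    · rw [killingForm_apply_apply]
      refine LinearMap.trace_eq_zero_of_mapsTo_ne hdirect (fun i => i + (1 + j)) (fun i => ?_) ?_
      · simp; omega
      · intro i v hv
        have := hgrade _ _ _ _ hx (hgrade _ _ _ _ hw hv)
        rw [show i + (1 + j) = 1 + (j + i) by ring]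
        exact this
  have hker : killingForm ℂ L x = 0 := by
    rw [← LinearMap.ker_eq_top, eq_top_iff, ← hdirect.submodule_iSup_eq_top, iSup_le_iff]
    intro j w hw
    exact hk0 j w hw
  have hbot := LieAlgebra.IsKilling.ker_killingForm_eq_bot ℂ L
  apply hx0
  have : x ∈ LinearMap.ker (killingForm ℂ L) := hker
  rwa [hbot, Submodule.mem_bot] at this
end
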